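/- Let c = (c₁,…,c_n), where c₁,…,c_n are positive integers, and let ρ ∈ W_c be the word obtained from Id_c by moving all of the 1's to the end of the word, i.e., ρ = 2^{c₂} 3^{c₃} ⋯ n^{c_n} 1^{c₁} (where i^{c_i} denotes c_i consecutive copies of the letter i). Then ⟨ρ⟩_fast = n − 1 and ⟨ρ⟩_slow = c₂ + c₃ + ⋯ + c_n. -/

import Mathlib

lemma foldr_max_mem {w : List ℕ} (h : w ≠ []) : w.foldr max 0 ∈ w := by
  induction w with
  | nil => exact absurd rfl h
  | cons a l ih =>
    rcases eq_or_ne l [] with rfl | hl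
    · simp
    · have hm := ih hl
      simp only [List.foldr_cons]
      rcases max_choice a (l.foldr max 0) with h' | h' <;> rw [h']
      · exact List.mem_cons_self
      · exact List.mem_cons_of_mem _ hm

lemma headI_mem {α : Type*} [Inhabited α] {l : List α} (h : l ≠ []) : l.headI ∈ l := by
  cases l with
  | nil => exact absurd rfl h
  | cons a t => simp

/-- `blocks n w` is the list of maximal (possibly empty) blocks of `w`
separated by occurrences of the letter `n`; that is, if `n` occurs `k` times
in `w`, then `blocks n w = [A₁, A₂, …, A_{k+1}]` where `w = A₁ n A₂ n ⋯ n A_{k+1}`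
and no `Aᵢ` contains the letter `n`. -/
def blocks (n : ℕ) : List ℕ → List (List ℕ)
  | [] => [[]]
  | a :: l =>
    if a = n then [] :: blocks n l
    else (a :: (blocks n l).headI) :: (blocks n l).tail

lemma blocks_ne_nil (n : ℕ) (w : List ℕ) : blocks n w ≠ [] := by
  cases w with
  | nil => simp [blocks]
  | cons a l =>
    simp only [blocks]
    split <;> simp

lemma blocks_length {n : ℕ} {w : List ℕ} : ∀ {A : List ℕ}, A ∈ blocks n w →
    A.length + w.count n ≤ w.length := by
  induction w with
  | nil =>
    intro A hA
    simp only [blocks, List.mem_singleton] at hA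
    subst hA; simp
  | cons a l ih =>
    intro A hA
    by_cases h : a = n
    · subst h
      simp only [blocks, if_pos rfl] at hA
      have hcc : (a :: l).count a = l.count a + 1 := by simp
      cases hA with
      | head =>
        have := List.count_le_length (a := a) (l := l)
        simp only [List.length_nil, List.length_cons, hcc]
        omega
      | tail _ h1 =>
        have := ih h1
        simp only [List.length_cons, hcc]
        omega
    · simp only [blocks, if_neg h] at hA
      have hcc : (a :: l).count n = l.count n := by
        simp [List.count_cons, h]
      cases hA with
      | head =>
        have := ih (headI_mem (blocks_ne_nil n l))
        simp only [List.length_cons, hcc]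
        omega
      | tail _ h1 =>
        have := ih (List.mem_of_mem_tail h1)
        simp only [List.length_cons, hcc]
        omega

/-- The generalized stack-sorting map `fast` (the convention in which a letter may
sit on top of a copy of itself in the stack): `fast ε = ε`, and if
`w = A₁ n A₂ n ⋯ n A_{k+1}` where `n` is the largest letter of `w` (occurring
`k` times) and the `Aᵢ` contain only letters smaller than `n`, then
`fast w = fast A₁ ++ fast A₂ ++ ⋯ ++ fast A_{k+1} ++ n ⋯ n` (with `k` copies of `n`). -/
def fast (w : List ℕ) : List ℕ :=
  if h : w = [] then []
  else
    ((blocks (w.foldr max 0) w).attach.map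
      fun (A : {x // x ∈ blocks (w.foldr max 0) w}) =>
      have : A.1.length < w.length := by
        have h1 := blocks_length A.2
        have h2 : 0 < w.count (w.foldr max 0) :=
          List.count_pos_iff.mpr (foldr_max_mem h)
        omega
      fast A.1).flatten ++ List.replicate (w.count (w.foldr max 0)) (w.foldr max 0)
termination_by w.length

/-- The generalized stack-sorting map `slow` (the convention in which a letter may
not sit on top of a copy of itself in the stack): `slow ε = ε`, and if
`w = A₁ n A₂ n ⋯ n A_{k+1}` where `n` is the largest letter of `w` (occurring
`k` times) and the `Aᵢ` contain only letters smaller than `n`, then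
`slow w = slow A₁ ++ slow A₂ ++ [n] ++ slow A₃ ++ [n] ++ ⋯ ++ slow A_{k+1} ++ [n]`. -/
def slow (w : List ℕ) : List ℕ :=
  if h : w = [] then []
  else
    (have : (blocks (w.foldr max 0) w).headI.length < w.length := by
      have h1 := blocks_length (headI_mem (blocks_ne_nil (w.foldr max 0) w))
      have h2 : 0 < w.count (w.foldr max 0) :=
        List.count_pos_iff.mpr (foldr_max_mem h)
      omega
     slow (blocks (w.foldr max 0) w).headI) ++
    ((blocks (w.foldr max 0) w).tail.attach.map
      fun (A : {x // x ∈ (blocks (w.foldr max 0) w).tail}) =>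
      have : A.1.length < w.length := by
        have h1 := blocks_length (List.mem_of_mem_tail A.2)
        have h2 : 0 < w.count (w.foldr max 0) :=
          List.count_pos_iff.mpr (foldr_max_mem h)
        omega
      slow A.1 ++ [w.foldr max 0]).flatten
termination_by w.length

/-- Membership in `W_c`: `w` is a word over the positive integers with exactly
`cᵢ` copies of the letter `i` for each `1 ≤ i ≤ n = c.length` (and no other letters). -/
def InW (c : List ℕ) (w : List ℕ) : Prop :=
  0 ∉ w ∧ ∀ i : ℕ, w.count (i + 1) = c.getD i 0

/-- The identity word `Id_c = 1^{c₁} 2^{c₂} ⋯ n^{c_n}`, the unique word in `W_c`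
whose letters are nondecreasing from left to right. -/
def idWord (c : List ℕ) : List ℕ :=
  ((List.range c.length).map fun i => List.replicate (c.getD i 0) (i + 1)).flatten

/-- The word `ρ = 2^{c₂} 3^{c₃} ⋯ n^{c_n} 1^{c₁} ∈ W_c`, obtained from `Id_c` by
moving all of the `1`'s to the end. -/
def rhoWord (c : List ℕ) : List ℕ :=
  (((List.range (c.length - 1)).map fun i =>
      List.replicate (c.getD (i + 1) 0) (i + 2)).flatten) ++
    List.replicate (c.getD 0 0) 1

lemma foldr_max_le {n : ℕ} {w : List ℕ} (h : ∀ x ∈ w, x ≤ n) : w.foldr max 0 ≤ n := by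
  induction w with
  | nil => simp
  | cons a l ih => simp_all

lemma le_foldr_max {x : ℕ} {w : List ℕ} (h : x ∈ w) : x ≤ w.foldr max 0 := by
  induction w with
  | nil => simp at h
  | cons a l ih =>
    rcases List.mem_cons.1 h with rfl | h
    · simp
    · simp [ih h]

lemma foldr_max_eq {n : ℕ} {w : List ℕ} (h : ∀ x ∈ w, x ≤ n) (hn : n ∈ w) :
    w.foldr max 0 = n :=
  le_antisymm (foldr_max_le h) (le_foldr_max hn)

lemma blocks_of_notMem {n : ℕ} {w : List ℕ} (h : n ∉ w) : blocks n w = [w] := by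
  induction w with
  | nil => rfl
  | cons a l ih =>
    simp only [List.mem_cons, not_or] at h
    simp [blocks, ih h.2, Ne.symm h.1]

lemma blocks_append_cons (n : ℕ) (x y : List ℕ) :
    blocks n (x ++ n :: y) = blocks n x ++ blocks n y := by
  induction x with
  | nil => simp [blocks]
  | cons a l ih =>
    obtain ⟨b, bs, hb⟩ := List.exists_cons_of_ne_nil (blocks_ne_nil n l)
    by_cases h : a = n <;> simp [blocks, h, ih, hb]

@[simp] lemma fast_nil : fast [] = [] := by
  rw [fast]; simp

@[simp] lemma slow_nil : slow [] = [] := by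
  rw [slow]; simp

/-- The recursion for `fast` holds with any upper bound of the letters in place of the maximum. -/
lemma fast_eq_of_le {n : ℕ} {w : List ℕ} (h : ∀ x ∈ w, x ≤ n) :
    fast w = ((blocks n w).map fast).flatten ++ List.replicate (w.count n) n := by
  by_cases hn : n ∈ w
  · have hm := foldr_max_eq h hn
    rw [fast, dif_neg (List.ne_nil_of_mem hn)]
    subst hm
    congr 2
    exact List.attach_map_val (f := fast)
  · simp [blocks_of_notMem hn, List.count_eq_zero_of_not_mem hn]

/-- The recursion for `slow` holds with any upper bound of the letters in place of the maximum. -/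
lemma slow_eq_of_le {n : ℕ} {w : List ℕ} (h : ∀ x ∈ w, x ≤ n) :
    slow w = slow (blocks n w).headI ++
      ((blocks n w).tail.map fun A => slow A ++ [n]).flatten := by
  by_cases hn : n ∈ w
  · have hm := foldr_max_eq h hn
    rw [slow, dif_neg (List.ne_nil_of_mem hn)]
    subst hm
    congr 2
    exact List.attach_map_val (f := fun A => slow A ++ [w.foldr max 0])
  · simp [blocks_of_notMem hn]

lemma slow_append_cons {n : ℕ} {u v : List ℕ} (hu : ∀ x ∈ u, x ≤ n) (hv : ∀ x ∈ v, x < n) :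
    slow (u ++ n :: v) = slow u ++ slow v ++ [n] := by
  have hn : n ∉ v := fun h => (hv n h).false
  have huv : ∀ x ∈ u ++ n :: v, x ≤ n := by
    simp only [List.mem_append, List.mem_cons]
    rintro x (h | rfl | h)
    exacts [hu x h, le_rfl, (hv x h).le]
  obtain ⟨b, bs, hb⟩ := List.exists_cons_of_ne_nil (blocks_ne_nil n u)
  rw [slow_eq_of_le huv, slow_eq_of_le hu, blocks_append_cons, blocks_of_notMem hn, hb]
  simp

lemma fast_append_singleton {n : ℕ} {u : List ℕ} (hu : ∀ x ∈ u, x ≤ n) :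
    fast (u ++ [n]) = fast u ++ [n] := by
  have hun : ∀ x ∈ u ++ [n], x ≤ n := by
    simp only [List.mem_append, List.mem_singleton]
    rintro x (h | rfl)
    exacts [hu x h, le_rfl]
  rw [fast_eq_of_le hun, fast_eq_of_le hu, blocks_append_cons]
  simp [blocks, List.replicate_succ']

lemma blocks_replicate_append {n : ℕ} {v : List ℕ} (hv : n ∉ v) (k : ℕ) :
    blocks n (List.replicate k n ++ v) = List.replicate k [] ++ [v] := by
  induction k with
  | zero => simp [blocks_of_notMem hv]
  | succ k ih => simp [List.replicate_succ, blocks, ih]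

lemma fast_append_replicate_append {n k : ℕ} {u v : List ℕ} (hk : 0 < k)
    (hu : ∀ x ∈ u, x < n) (hv : ∀ x ∈ v, x < n) :
    fast (u ++ List.replicate k n ++ v) = fast u ++ fast v ++ List.replicate k n := by
  have hnu : n ∉ u := fun h => (hu n h).false
  have hnv : n ∉ v := fun h => (hv n h).false
  have h : ∀ x ∈ u ++ List.replicate k n ++ v, x ≤ n := by
    simp only [List.mem_append, List.mem_replicate]
    rintro x ((h | h) | h)
    exacts [(hu x h).le, h.2.le, (hv x h).le]
  obtain ⟨k, rfl⟩ := Nat.exists_eq_succ_of_ne_zero hk.ne'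
  have hb : blocks n (u ++ List.replicate (k + 1) n ++ v) = u :: (List.replicate k [] ++ [v]) := by
    rw [List.replicate_succ, List.append_assoc, List.cons_append, blocks_append_cons,
      blocks_of_notMem hnu, blocks_replicate_append hnv, List.singleton_append]
  rw [fast_eq_of_le h, hb]
  simp [List.count_eq_zero_of_not_mem hnu, List.count_eq_zero_of_not_mem hnv]

/-- A map that commutes with appending a maximal letter commutes with appending a nondecreasing
word of maximal letters. -/
lemma map_append_sorted {f : List ℕ → List ℕ}
    (hf : ∀ (n : ℕ) (u : List ℕ), (∀ x ∈ u, x ≤ n) → f (u ++ [n]) = f u ++ [n])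
    {w t : List ℕ} (ht : t.Pairwise (· ≤ ·)) (hwt : ∀ x ∈ w, ∀ y ∈ t, x ≤ y) :
    f (w ++ t) = f w ++ t := by
  induction t using List.reverseRecOn with
  | nil => simp
  | append_singleton t a ih =>
    rw [List.pairwise_append] at ht
    rw [← List.append_assoc, hf, ih ht.1 fun x hx y hy => hwt x hx y (by simp [hy]),
      List.append_assoc]
    intro x hx
    rcases List.mem_append.1 hx with hx | hx
    · exact hwt x hx a (by simp)
    · exact ht.2.2 x hx a (by simp)

lemma fast_append_sorted {w t : List ℕ} (ht : t.Pairwise (· ≤ ·))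
    (hwt : ∀ x ∈ w, ∀ y ∈ t, x ≤ y) : fast (w ++ t) = fast w ++ t :=
  map_append_sorted (fun _ _ => fast_append_singleton) ht hwt

lemma slow_append_sorted {w t : List ℕ} (ht : t.Pairwise (· ≤ ·))
    (hwt : ∀ x ∈ w, ∀ y ∈ t, x ≤ y) : slow (w ++ t) = slow w ++ t :=
  map_append_sorted (fun _ _ h => by simpa using slow_append_cons h (v := []) (by simp)) ht hwt

lemma fast_sorted {t : List ℕ} (ht : t.Pairwise (· ≤ ·)) : fast t = t := by
  simpa using fast_append_sorted (w := []) ht (by simp)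

lemma slow_sorted {t : List ℕ} (ht : t.Pairwise (· ≤ ·)) : slow t = t := by
  simpa using slow_append_sorted (w := []) ht (by simp)

/-- If each application of `f` moves the word `1 ⋯ 1` one block of `L` to the left, then it takes
exactly `L.length` applications to bring it to the front. -/
lemma exists_iterate_and_sInf_eq_length {f : List ℕ → List ℕ} {L : List (List ℕ)} {m : ℕ}
    (hm : L ≠ [] → 0 < m) (hL : ∀ b ∈ L, b ≠ []) (hone : ∀ b ∈ L, 1 ∉ b)
    (hf : ∀ L₁ b L₂, L = L₁ ++ b :: L₂ →
      f (L₁.flatten ++ b ++ List.replicate m 1 ++ L₂.flatten) =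
        L₁.flatten ++ List.replicate m 1 ++ b ++ L₂.flatten) :
    (∃ k, f^[k] (L.flatten ++ List.replicate m 1) = List.replicate m 1 ++ L.flatten) ∧
    sInf {k | f^[k] (L.flatten ++ List.replicate m 1) = List.replicate m 1 ++ L.flatten} =
      L.length := by
  have key : ∀ k L₁ L₂, L = L₁ ++ L₂ → L₂.length = k →
      f^[k] (L.flatten ++ List.replicate m 1) =
        L₁.flatten ++ List.replicate m 1 ++ L₂.flatten := by
    intro k
    induction k with
    | zero =>
      intro L₁ L₂ h h2
      obtain rfl := List.length_eq_zero_iff.1 h2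
      simp [h]
    | succ k ih =>
      intro L₁ L₂ h h2
      obtain ⟨b, L₂, rfl⟩ := List.exists_cons_of_length_eq_add_one h2
      rw [Function.iterate_succ_apply', ih (L₁ ++ [b]) L₂ (by simp [h]) (by simpa using h2)]
      simpa using hf L₁ b L₂ h
  have hmem : L.length ∈
      {k | f^[k] (L.flatten ++ List.replicate m 1) = List.replicate m 1 ++ L.flatten} := by
    simpa using key L.length [] L rfl rfl
  refine ⟨⟨_, hmem⟩, le_antisymm (Nat.sInf_le hmem) (le_csInf ⟨_, hmem⟩ fun k hk => ?_)⟩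
  by_contra! hlt
  rw [Set.mem_ofPred_eq, key k (L.take (L.length - k)) (L.drop (L.length - k)) (by simp)
    (by simp; omega)] at hk
  cases L with
  | nil => simp at hlt
  | cons b L =>
    obtain ⟨a, b, rfl⟩ := List.exists_cons_of_ne_nil (hL b (by simp))
    obtain ⟨m, rfl⟩ := Nat.exists_eq_succ_of_ne_zero (hm (by simp)).ne'
    obtain ⟨j, hj⟩ : ∃ j, ((a :: b) :: L).length - k = j + 1 := ⟨_, (Nat.sub_add_cancel
      (Nat.sub_pos_of_lt hlt)).symm⟩
    rw [hj] at hk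
    simp only [List.take_succ_cons, List.flatten_cons, List.cons_append, List.replicate_succ,
      List.cons.injEq] at hk
    exact hone (a :: b) (by simp) (by simp [hk.1])

lemma slow_move_left {u t : List ℕ} {a m : ℕ} (ha : 1 < a)
    (h : (u ++ a :: t).Pairwise (· ≤ ·)) :
    slow (u ++ [a] ++ List.replicate m 1 ++ t) = u ++ List.replicate m 1 ++ [a] ++ t := by
  rw [List.pairwise_append, List.pairwise_cons] at h
  obtain ⟨hu, ⟨hat, ht⟩, hut⟩ := h
  rw [slow_append_sorted ht, List.append_assoc, List.singleton_append, slow_append_cons,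
    slow_sorted hu, slow_sorted (List.pairwise_replicate.2 (Or.inr le_rfl))]
  · exact fun x hx => hut x hx a (by simp)
  · intro x hx
    rwa [List.eq_of_mem_replicate hx]
  · simp only [List.mem_append, List.mem_singleton]
    rintro x ((hx | rfl) | hx) y hy
    · exact hut x hx y (by simp [hy])
    · exact hat y hy
    · rw [List.eq_of_mem_replicate hx]
      exact ha.le.trans (hat y hy)

lemma fast_move_left {u t : List ℕ} {a k m : ℕ} (ha : 1 < a) (hk : 0 < k)
    (hu : u.Pairwise (· ≤ ·)) (ht : t.Pairwise (· ≤ ·)) (hua : ∀ x ∈ u, x < a)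
    (hat : ∀ y ∈ t, a ≤ y) :
    fast (u ++ List.replicate k a ++ List.replicate m 1 ++ t) =
      u ++ List.replicate m 1 ++ List.replicate k a ++ t := by
  rw [fast_append_sorted ht, fast_append_replicate_append hk hua,
    fast_sorted hu, fast_sorted (List.pairwise_replicate.2 (Or.inr le_rfl))]
  · intro x hx
    rwa [List.eq_of_mem_replicate hx]
  · simp only [List.mem_append]
    rintro x ((hx | hx) | hx) y hy
    · exact (hua x hx).le.trans (hat y hy)
    · rw [List.eq_of_mem_replicate hx]
      exact hat y hy
    · rw [List.eq_of_mem_replicate hx]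
      exact ha.le.trans (hat y hy)

/-- The list of the constant words `2^{c₂}, …, n^{c_n}`. -/
def largeRuns (c : List ℕ) : List (List ℕ) :=
  (List.range (c.length - 1)).map fun i => List.replicate (c.getD (i + 1) 0) (i + 2)

lemma rhoWord_eq (c : List ℕ) :
    rhoWord c = (largeRuns c).flatten ++ List.replicate (c.getD 0 0) 1 := rfl

lemma idWord_eq (c : List ℕ) :
    idWord c = List.replicate (c.getD 0 0) 1 ++ (largeRuns c).flatten := by
  cases c with
  | nil => rfl
  | cons a l => simp [idWord, largeRuns, List.range_succ_eq_map, Function.comp_def]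

lemma length_largeRuns_flatten (c : List ℕ) :
    (largeRuns c).flatten.length = (c.drop 1).sum := by
  cases c with
  | nil => rfl
  | cons a l =>
    simp only [largeRuns, List.length_flatten, List.map_map, Function.comp_def,
      List.length_replicate, List.length_cons, Nat.add_sub_cancel, List.getD_cons_succ,
      List.drop_succ_cons, List.drop_zero]
    congr 1
    refine List.ext_getElem (by simp) fun i h₁ h₂ => ?_
    simp [h₂]

lemma exists_of_mem_largeRuns {c : List ℕ} (hc : ∀ x ∈ c, 0 < x) {b : List ℕ}
    (hb : b ∈ largeRuns c) : ∃ k a, 0 < k ∧ 1 < a ∧ b = List.replicate k a := by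
  simp only [largeRuns, List.mem_map, List.mem_range] at hb
  obtain ⟨i, hi, rfl⟩ := hb
  refine ⟨_, _, hc _ ?_, by omega, rfl⟩
  rw [List.getD_eq_getElem _ _ (by omega)]
  exact List.getElem_mem _

lemma pairwise_largeRuns (c : List ℕ) :
    (largeRuns c).Pairwise fun b b' => ∀ x ∈ b, ∀ y ∈ b', x < y := by
  rw [largeRuns, List.pairwise_map]
  refine List.pairwise_lt_range.imp fun {i j} hij x hx y hy => ?_
  rw [List.eq_of_mem_replicate hx, List.eq_of_mem_replicate hy]
  omega

lemma pairwise_largeRuns_flatten {c : List ℕ} (hc : ∀ x ∈ c, 0 < x) :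
    (largeRuns c).flatten.Pairwise (· ≤ ·) := by
  refine List.pairwise_flatten.2 ⟨fun b hb => ?_, (pairwise_largeRuns c).imp
    fun h x hx y hy => (h x hx y hy).le⟩
  obtain ⟨k, a, -, -, rfl⟩ := exists_of_mem_largeRuns hc hb
  exact List.pairwise_replicate.2 (Or.inr le_rfl)

lemma one_lt_of_mem_largeRuns {c : List ℕ} (hc : ∀ x ∈ c, 0 < x) {b : List ℕ}
    (hb : b ∈ largeRuns c) {x : ℕ} (hx : x ∈ b) : 1 < x := by
  obtain ⟨k, a, -, ha, rfl⟩ := exists_of_mem_largeRuns hc hb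
  rwa [List.eq_of_mem_replicate hx]

lemma getD_zero_pos {c : List ℕ} (hc : ∀ x ∈ c, 0 < x) (h : largeRuns c ≠ []) :
    0 < c.getD 0 0 := by
  cases c with
  | nil => exact absurd rfl h
  | cons a l => exact hc a (by simp)

lemma fast_rhoWord {c : List ℕ} (hc : ∀ x ∈ c, 0 < x) :
    (∃ k, fast^[k] (rhoWord c) = idWord c) ∧
    sInf {k | fast^[k] (rhoWord c) = idWord c} = c.length - 1 := by
  have hlen : (largeRuns c).length = c.length - 1 := by simp [largeRuns]
  rw [rhoWord_eq, idWord_eq, ← hlen]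
  refine exists_iterate_and_sInf_eq_length (getD_zero_pos hc) (fun b hb => ?_)
    (fun b hb h => (one_lt_of_mem_largeRuns hc hb h).false) fun L₁ b L₂ h => ?_
  · obtain ⟨k, a, hk, -, rfl⟩ := exists_of_mem_largeRuns hc hb
    simpa using hk.ne'
  · obtain ⟨k, a, hk, ha, rfl⟩ := exists_of_mem_largeRuns hc (b := b) (by simp [h])
    have hak : a ∈ List.replicate k a := List.mem_replicate.2 ⟨hk.ne', rfl⟩
    have hs := pairwise_largeRuns_flatten hc
    have hp := pairwise_largeRuns c
    rw [h, List.flatten_append, List.flatten_cons, List.pairwise_append,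
      List.pairwise_append] at hs
    rw [h, List.pairwise_append] at hp
    refine fast_move_left ha hk hs.1 hs.2.1.2.1 (fun x hx => ?_)
      fun y hy => hs.2.1.2.2 a hak y hy
    obtain ⟨b, hb, hx⟩ := List.mem_flatten.1 hx
    exact hp.2.2 b hb _ (by simp) x hx a hak

lemma slow_rhoWord {c : List ℕ} (hc : ∀ x ∈ c, 0 < x) :
    (∃ k, slow^[k] (rhoWord c) = idWord c) ∧
    sInf {k | slow^[k] (rhoWord c) = idWord c} = (c.drop 1).sum := by
  have hs := pairwise_largeRuns_flatten hc
  have hlt : ∀ x ∈ (largeRuns c).flatten, 1 < x := fun x hx => by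
    obtain ⟨b, hb, hx⟩ := List.mem_flatten.1 hx
    exact one_lt_of_mem_largeRuns hc hb hx
  have hpos : (largeRuns c).flatten ≠ [] → 0 < c.getD 0 0 := fun h =>
    getD_zero_pos hc fun h' => h (by simp [h'])
  rw [rhoWord_eq, idWord_eq, ← length_largeRuns_flatten]
  generalize (largeRuns c).flatten = s at hs hlt hpos
  have hfl : (s.map fun a => [a]).flatten = s := by
    induction s <;> simp_all
  have key := exists_iterate_and_sInf_eq_length (f := slow) (L := s.map fun a => [a])
    (m := c.getD 0 0) (by simpa using hpos) (by simp)
    (fun b hb h => ?_) fun L₁ b L₂ h => ?_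
  · rwa [hfl, List.length_map] at key
  · obtain ⟨a, ha, rfl⟩ := List.mem_map.1 hb
    exact (hlt 1 (by rwa [List.mem_singleton.1 h])).false
  · obtain ⟨a, ha, rfl⟩ := List.mem_map.1 (show b ∈ s.map fun a => [a] by simp [h])
    rw [h, List.flatten_append, List.flatten_cons, List.singleton_append] at hfl
    exact slow_move_left (hlt a ha) (hfl ▸ hs)

/-- Let `c = (c₁, …, c_n)`, where `c₁, …, c_n` are positive integers, and let
`ρ = 2^{c₂} 3^{c₃} ⋯ n^{c_n} 1^{c₁} ∈ W_c` be obtained from `Id_c` by moving all the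
`1`'s to the end. Then `⟨ρ⟩_fast = n - 1` and `⟨ρ⟩_slow = c₂ + c₃ + ⋯ + c_n`. -/
theorem dist_fast_slow_rho (c : List ℕ) (hc : ∀ x ∈ c, 0 < x) :
    (∃ k, fast^[k] (rhoWord c) = idWord c) ∧
    sInf {k | fast^[k] (rhoWord c) = idWord c} = c.length - 1 ∧
    (∃ k, slow^[k] (rhoWord c) = idWord c) ∧
    sInf {k | slow^[k] (rhoWord c) = idWord c} = (c.drop 1).sum := by
  exact ⟨(fast_rhoWord hc).1, (fast_rhoWord hc).2, slow_rhoWord hc⟩
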